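/- Let D ⊊ C ⊆ {0,1}^n be extremal concept classes satisfying the cubical colour condition. Let c and c' be distinct maximal cubes of C not contained in D, with colour sets I and I' and special vertices v and v' respectively. Then v and v' differ on at least one coordinate in I ∪ I'. -/

import Mathlib

variable {n : ℕ}

/-- Coordinatewise intersection (Boolean product) of two vertices. -/
def interV {α : Type*} (v w : α → Bool) : α → Bool := fun i => v i && w i

/-- A class is intersection closed if it is closed under coordinatewise products. -/
def IntersectionClosed {α : Type*} (C : Set (α → Bool)) : Prop :=
  ∀ v ∈ C, ∀ w ∈ C, interV v w ∈ C

/-- The intersection closure: all iterated intersections of nonempty finite subsets. -/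
def interClosure {α : Type*} (C : Set (α → Bool)) : Set (α → Bool) :=
  {x | ∃ S : Finset (α → Bool), S.Nonempty ∧ ↑S ⊆ C ∧ x = fun i => S.inf fun u => u i}

/-- Coordinate projection to the coordinates in `J`. -/
def proj (J : Finset (Fin n)) (v : Fin n → Bool) : {i // i ∈ J} → Bool := fun j => v j.1

/-- `C` shatters `I` if the projection of `C` to `I` is the full cube. -/
def Shatters (C : Set (Fin n → Bool)) (I : Finset (Fin n)) : Prop :=
  proj I '' C = Set.univ

/-- The VC dimension: the largest cardinality of a shattered set of coordinates. -/
noncomputable def VCdim (C : Set (Fin n → Bool)) : ℕ :=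
  sSup {k | ∃ I : Finset (Fin n), I.card = k ∧ Shatters C I}

/-- A shortest path in `A` from `u` to `v`: a sequence of length `hammingDist u v`
starting at `u`, ending at `v`, with all vertices in `A` and consecutive vertices
at Hamming distance `1`. -/
def IsShortestPath (A : Set (Fin n → Bool)) (u v : Fin n → Bool)
    (seq : Fin (hammingDist u v + 1) → Fin n → Bool) : Prop :=
  seq 0 = u ∧ seq (Fin.last (hammingDist u v)) = v ∧ (∀ i, seq i ∈ A) ∧
    ∀ i : Fin (hammingDist u v), hammingDist (seq i.castSucc) (seq i.succ) = 1

/-- A class is shortest-path closed if any two of its vertices are joined by a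
shortest path inside the class. -/
def SPClosed (C : Set (Fin n → Bool)) : Prop :=
  ∀ u ∈ C, ∀ v ∈ C, ∃ seq, IsShortestPath C u v seq

/-- A cube with colour set `I` (and some anchor `a` outside `I`). -/
def IsCubeOn (I : Finset (Fin n)) (c : Set (Fin n → Bool)) : Prop :=
  ∃ a : Fin n → Bool, c = {v | ∀ i, i ∉ I → v i = a i}

/-- A cube (with some colour set). -/
def IsCube (c : Set (Fin n → Bool)) : Prop := ∃ I, IsCubeOn I c

/-- `c` is a maximal cube of `A`: a cube contained in `A` not properly contained in
another cube contained in `A`. -/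
def MaximalCubeIn (A c : Set (Fin n → Bool)) : Prop :=
  IsCube c ∧ c ⊆ A ∧ ∀ c', IsCube c' → c' ⊆ A → c ⊆ c' → c' = c

/-- A class is extremal if every shattered colour set is witnessed by a cube inside
the class. -/
def Extremal (C : Set (Fin n → Bool)) : Prop :=
  ∀ I : Finset (Fin n), Shatters C I → ∃ c, IsCubeOn I c ∧ c ⊆ C

/-- The cubical colour condition for the pair `(C, D)`: every cube contained in `C`
that is not maximal in `C` has a cube in `D` with the same colour set. -/
def CCC (C D : Set (Fin n → Bool)) : Prop :=
  ∀ I c, IsCubeOn I c → c ⊆ C → ¬ MaximalCubeIn C c →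
    ∃ c', IsCubeOn I c' ∧ c' ⊆ D

/-- `A` has an edge of colour `i`: two vertices of `A` differing exactly at `i`. -/
def HasEdge (A : Set (Fin n → Bool)) (i : Fin n) : Prop :=
  ∃ v ∈ A, ∃ w ∈ A, v i ≠ w i ∧ ∀ j, j ≠ i → v j = w j

/-- An unlabelled compression scheme of size `k` for `C`. -/
def HasCompression (C : Set (Fin n → Bool)) (k : ℕ) : Prop :=
  ∃ r : (Fin n → Bool) → Finset (Fin n),
    Set.InjOn r C ∧ (∀ v ∈ C, (r v).card ≤ k) ∧
      ∀ v ∈ C, ∀ w ∈ C, v ≠ w → ∃ i ∈ r v ∪ r w, v i ≠ w i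

/-- Coordinates where `v` is `1` but `w` is `0`. -/
def delta (v w : Fin n → Bool) : Finset (Fin n) :=
  Finset.univ.filter fun i => v i = true ∧ w i = false

/-- The vertex obtained from `v` by setting to `0` the `j` smallest (in the order
induced by the permutation `π`) coordinates of `delta v w`. -/
def stepVert (π : Equiv.Perm (Fin n)) (v w : Fin n → Bool) (j : ℕ) : Fin n → Bool :=
  fun i =>
    if i ∈ delta v w ∧ ((delta v w).filter fun i' => π i' < π i).card < j then false
    else v i

/-- The shortest-path closure construction of `C` (with respect to the linear order
on coordinates induced by `π`). -/
def spClosure (π : Equiv.Perm (Fin n)) (C : Set (Fin n → Bool)) : Set (Fin n → Bool) :=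
  {x | ∃ v ∈ C, ∃ w ∈ C, w ≤ v ∧ ∃ j ≤ (delta v w).card, x = stepVert π v w j}

/-- Coordinatewise XOR with `b` (a change of origin). -/
def xorShift (b : Fin n → Bool) (C : Set (Fin n → Bool)) : Set (Fin n → Bool) :=
  (fun v i => xor (v i) (b i)) '' C

/-- The `k`-close cube condition. -/
def KCloseCube (C : Set (Fin n → Bool)) (k : ℕ) : Prop :=
  ∃ v : Fin n → Bool, ∀ J : Finset (Fin n), J.card = k + 1 →
    ∃ b : {i // i ∈ J} → Bool, hammingDist b (proj J v) ≤ 1 ∧ b ∉ proj J '' C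

/-- The vertex obtained from `u` by flipping the coordinates in `A`. -/
def flipOn (A : Finset (Fin n)) (u : Fin n → Bool) : Fin n → Bool :=
  fun i => if i ∈ A then !u i else u i

/-- The indicator function of the vertices that agree with `s` on `K`. -/
def agreeInd (s : Fin n → Bool) (K : Finset (Fin n)) (x : Fin n → Bool) : ℚ :=
  if ∀ i ∈ K, x i = s i then 1 else 0

/-- The alternating sum of `f` over the cube with colour set `K` through `u`, normalised
so that `u` has coefficient `1`. -/
def altSum (K : Finset (Fin n)) (u : Fin n → Bool) (f : (Fin n → Bool) → ℚ) : ℚ :=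
  ∑ A ∈ K.powerset, (-1) ^ A.card * f (flipOn A u)

lemma flipOn_empty (u : Fin n → Bool) : flipOn ∅ u = u := by
  funext i; simp [flipOn]

lemma altSum_eq_zero_of_indep {K : Finset (Fin n)} {i : Fin n} (hi : i ∈ K)
    (u : Fin n → Bool) {f : (Fin n → Bool) → ℚ}
    (hf : ∀ x y : Fin n → Bool, (∀ j, j ≠ i → x j = y j) → f x = f y) :
    altSum K u f = 0 := by
  rw [altSum, ← Finset.insert_erase hi, Finset.sum_powerset_insert (Finset.notMem_erase i K),
    ← Finset.sum_add_distrib]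
  refine Finset.sum_eq_zero fun A hA => ?_
  have hiA : i ∉ A := fun h => Finset.notMem_erase i K (Finset.mem_powerset.1 hA h)
  have h : f (flipOn (insert i A) u) = f (flipOn A u) :=
    hf _ _ fun j hj => by simp [flipOn, hj]
  rw [Finset.card_insert_of_notMem hiA, h]
  ring

lemma altSum_eq_apply {K : Finset (Fin n)} {u : Fin n → Bool} {f : (Fin n → Bool) → ℚ}
    (hf : ∀ A ⊆ K, A.Nonempty → f (flipOn A u) = 0) : altSum K u f = f u := by
  rw [altSum, Finset.sum_eq_single ∅]
  · simp [flipOn_empty]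
  · intro A hA hne
    rw [hf A (Finset.mem_powerset.1 hA) (Finset.nonempty_iff_ne_empty.2 hne), mul_zero]
  · simp

lemma agreeInd_flipOn_eq_zero {s u : Fin n → Bool} {K A : Finset (Fin n)}
    (hu : ∀ i ∈ A, u i = s i) (hAK : A ⊆ K) (hA : A.Nonempty) :
    agreeInd s K (flipOn A u) = 0 := by
  obtain ⟨i, hi⟩ := hA
  refine if_neg fun h => ?_
  have h1 := h i (hAK hi)
  simp [flipOn, hi, hu i hi] at h1

lemma altSum_agreeInd_eq_zero {K L : Finset (Fin n)} (h : ¬ K ⊆ L) (s u : Fin n → Bool) :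
    altSum K u (agreeInd s L) = 0 := by
  obtain ⟨i, hiK, hiL⟩ := Finset.not_subset.1 h
  refine altSum_eq_zero_of_indep hiK u fun x y hxy => ?_
  have : (∀ j ∈ L, x j = s j) ↔ ∀ j ∈ L, y j = s j :=
    forall₂_congr fun j hj => by rw [hxy j (fun e => hiL (e ▸ hj))]
  simp only [agreeInd, this]

lemma altSum_agreeInd_self {K : Finset (Fin n)} {s u : Fin n → Bool}
    (hu : ∀ i ∈ K, u i = s i) : altSum K u (agreeInd s K) = 1 := by
  rw [altSum_eq_apply fun A hAK hA =>
    agreeInd_flipOn_eq_zero (fun i hi => hu i (hAK hi)) hAK hA]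
  exact if_pos hu

/-- Coefficient extraction: an alternating sum over a cube with colour set `K` reads off the
coefficient of the indicator function belonging to `K`. -/
lemma altSum_eq_coeff {C : Set (Fin n → Bool)} {s : Finset (Fin n) → Fin n → Bool}
    {T : Finset (Finset (Fin n))} {a : Finset (Fin n) → ℚ} {f : (Fin n → Bool) → ℚ}
    (hf : ∀ x ∈ C, f x = ∑ L ∈ T, a L * agreeInd (s L) L x)
    {K : Finset (Fin n)} (hK : K ∈ T) (hmax : ∀ L ∈ T, K ⊆ L → L ≠ K → a L = 0)
    {u : Fin n → Bool} (hu : ∀ i ∈ K, u i = s K i) (hcube : ∀ A ⊆ K, flipOn A u ∈ C) :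
    altSum K u f = a K := by
  have h1 : altSum K u f = ∑ L ∈ T, a L * altSum K u (agreeInd (s L) L) := by
    simp only [altSum, Finset.mul_sum]
    rw [Finset.sum_comm]
    refine Finset.sum_congr rfl fun A hA => ?_
    rw [hf _ (hcube A (Finset.mem_powerset.1 hA)), Finset.mul_sum]
    exact Finset.sum_congr rfl fun L _ => by ring
  rw [h1, Finset.sum_eq_single K]
  · rw [altSum_agreeInd_self hu, mul_one]
  · intro L hL hne
    by_cases hKL : K ⊆ L
    · rw [hmax L hL hKL hne, zero_mul]
    · rw [altSum_agreeInd_eq_zero hKL, mul_zero]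
  · exact fun h => absurd hK h

lemma flipOn_mem_of_isCubeOn {K : Finset (Fin n)} {c : Set (Fin n → Bool)}
    (hc : IsCubeOn K c) {u : Fin n → Bool} (hu : u ∈ c) {A : Finset (Fin n)} (hA : A ⊆ K) :
    flipOn A u ∈ c := by
  obtain ⟨a, rfl⟩ := hc
  intro i hi
  have : i ∉ A := fun h => hi (hA h)
  simpa [flipOn, this] using hu i hi

lemma exists_mem_of_isCubeOn {K : Finset (Fin n)} {c : Set (Fin n → Bool)}
    (hc : IsCubeOn K c) (s : Fin n → Bool) : ∃ u ∈ c, ∀ i ∈ K, u i = s i := by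
  obtain ⟨a, rfl⟩ := hc
  exact ⟨fun i => if i ∈ K then s i else a i, fun i hi => by simp [hi],
    fun i hi => by simp [hi]⟩

lemma proj_eq_proj_iff {K : Finset (Fin n)} {x y : Fin n → Bool} :
    proj K x = proj K y ↔ ∀ i ∈ K, x i = y i :=
  ⟨fun h i hi => congrFun h ⟨i, hi⟩, fun h => funext fun j => h j.1 j.2⟩

lemma shatters_iff {C : Set (Fin n → Bool)} {K : Finset (Fin n)} :
    Shatters C K ↔ ∀ s : Fin n → Bool, ∃ x ∈ C, ∀ i ∈ K, x i = s i := by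
  constructor
  · intro h s
    obtain ⟨x, hx, hxs⟩ : proj K s ∈ proj K '' C := by rw [h]; trivial
    exact ⟨x, hx, proj_eq_proj_iff.1 hxs⟩
  · intro h
    refine Set.eq_univ_of_forall fun b => ?_
    obtain ⟨x, hx, hxb⟩ := h fun i => if hi : i ∈ K then b ⟨i, hi⟩ else false
    exact ⟨x, hx, funext fun j => by simpa [proj] using hxb j.1 j.2⟩

lemma shatters_of_isCubeOn {C c : Set (Fin n → Bool)} {K : Finset (Fin n)}
    (hc : IsCubeOn K c) (hcC : c ⊆ C) : Shatters C K :=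
  shatters_iff.2 fun s =>
    let ⟨u, hu, hus⟩ := exists_mem_of_isCubeOn hc s
    ⟨u, hcC hu, hus⟩

lemma coeff_eq_zero_of_sum_eq_zero {D : Set (Fin n → Bool)} {T : Finset (Finset (Fin n))}
    (hT : ∀ K ∈ T, ∃ c, IsCubeOn K c ∧ c ⊆ D) (s : Finset (Fin n) → Fin n → Bool)
    {a : Finset (Fin n) → ℚ} (ha : ∀ x ∈ D, ∑ L ∈ T, a L * agreeInd (s L) L x = 0) :
    ∀ K ∈ T, a K = 0 := by
  by_contra! hcon
  obtain ⟨K₀, hK₀, haK₀⟩ := hcon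
  obtain ⟨K, hK⟩ := (T.filter fun K => a K ≠ 0).exists_maximal
    ⟨K₀, Finset.mem_filter.2 ⟨hK₀, haK₀⟩⟩
  obtain ⟨hKT, haK⟩ := Finset.mem_filter.1 hK.prop
  obtain ⟨c, hc, hcD⟩ := hT K hKT
  obtain ⟨u, hu, hus⟩ := exists_mem_of_isCubeOn hc (s K)
  have h := altSum_eq_coeff (f := fun _ => 0) (fun x hx => (ha x hx).symm) hKT
    (fun L hL hKL hne => by
      by_contra h0
      exact hne (le_antisymm (hK.le_of_ge (Finset.mem_filter.2 ⟨hL, h0⟩) hKL) hKL))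
    hus (fun A hA => hcD (flipOn_mem_of_isCubeOn hc hu hA))
  exact haK (by rw [← h]; simp [altSum])

open Classical in
/-- The family of sets shattered by `C`. -/
noncomputable def shatteredSets (C : Set (Fin n → Bool)) : Finset (Finset (Fin n)) :=
  Finset.univ.filter (Shatters C)

lemma mem_shatteredSets {C : Set (Fin n → Bool)} {K : Finset (Fin n)} :
    K ∈ shatteredSets C ↔ Shatters C K := by
  simp [shatteredSets]

/-- Pajor's inequality. -/
lemma card_le_card_shatteredSets (C : Set (Fin n → Bool)) :
    Nat.card C ≤ (shatteredSets C).card := by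
  classical
  set supp : (Fin n → Bool) → Finset (Fin n) := fun x => Finset.univ.filter fun i => x i = true
    with hsupp
  have hinj : Function.Injective supp := by
    intro x y h
    funext i
    have : (i ∈ supp x) = (i ∈ supp y) := by rw [h]
    exact Bool.eq_iff_iff.2 (by simpa [hsupp] using this)
  calc Nat.card C = (C.toFinset.image supp).card := by
        rw [Finset.card_image_of_injective _ hinj, Set.toFinset_card, Nat.card_eq_fintype_card]
    _ ≤ (C.toFinset.image supp).shatterer.card := Finset.card_le_card_shatterer _
    _ ≤ (shatteredSets C).card := by
        refine Finset.card_le_card fun K hK => ?_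
        rw [Finset.mem_shatterer] at hK
        rw [mem_shatteredSets, shatters_iff]
        intro s
        obtain ⟨U, hU, hKU⟩ := hK (Finset.filter_subset (fun i => s i = true) K)
        obtain ⟨x, hx, rfl⟩ := Finset.mem_image.1 hU
        refine ⟨x, Set.mem_toFinset.1 hx, fun i hi => ?_⟩
        have : i ∈ K ∩ supp x ↔ i ∈ K.filter fun i => s i = true := by rw [hKU]
        exact Bool.eq_iff_iff.2 (by simpa [hsupp, hi] using this)

/-- On an extremal class, the indicator functions indexed by the shattered sets span all
functions. -/
lemma Extremal.exists_coeff {C : Set (Fin n → Bool)} (hC : Extremal C)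
    (s : Finset (Fin n) → Fin n → Bool) (f : (Fin n → Bool) → ℚ) :
    ∃ a : Finset (Fin n) → ℚ,
      ∀ x ∈ C, f x = ∑ L ∈ shatteredSets C, a L * agreeInd (s L) L x := by
  classical
  set b : shatteredSets C → C → ℚ := fun L x => agreeInd (s L) L x with hb
  have hli : LinearIndependent ℚ b := by
    rw [Fintype.linearIndependent_iff]
    intro g hg L
    have h := coeff_eq_zero_of_sum_eq_zero (D := C) (T := shatteredSets C)
      (fun K hK => hC K (mem_shatteredSets.1 hK)) s
      (a := fun K => if hK : K ∈ shatteredSets C then g ⟨K, hK⟩ else 0) (fun x hx => by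
        have := congrFun hg ⟨x, hx⟩
        rw [← Finset.sum_coe_sort]
        simpa [hb, Finset.sum_apply] using this) L L.2
    simpa using h
  have hcard : Fintype.card (shatteredSets C) = Module.finrank ℚ (C → ℚ) := by
    refine le_antisymm hli.fintype_card_le_finrank ?_
    rw [Module.finrank_fintype_fun_eq_card, Fintype.card_coe, ← Nat.card_eq_fintype_card]
    exact card_le_card_shatteredSets C
  have hspan := hli.span_eq_top_of_card_eq_finrank' hcard
  have hmem : (fun x : C => f x) ∈ Submodule.span ℚ (Set.range b) := by rw [hspan]; trivial
  obtain ⟨g, hg⟩ := (Submodule.mem_span_range_iff_exists_fun ℚ).1 hmem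
  refine ⟨fun K => if hK : K ∈ shatteredSets C then g ⟨K, hK⟩ else 0, fun x hx => ?_⟩
  have := congrFun hg ⟨x, hx⟩
  rw [← Finset.sum_coe_sort]
  simpa [hb, Finset.sum_apply] using this.symm

/-- Under the cubical colour condition, a set shattered by `C` but not by `D` is a maximal
shattered set of `C`. -/
lemma CCC.eq_of_subset {C D : Set (Fin n → Bool)} (hccc : CCC C D) (hC : Extremal C)
    {K L : Finset (Fin n)} (hK : ¬ Shatters D K) (hL : Shatters C L) (hKL : K ⊆ L) :
    L = K := by
  by_contra hne
  obtain ⟨i, hiL, hiK⟩ := Finset.exists_of_ssubset (hKL.ssubset_of_ne (Ne.symm hne))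
  obtain ⟨_, ⟨a, rfl⟩, hsub⟩ := hC L hL
  have hle : {x : Fin n → Bool | ∀ i, i ∉ K → x i = a i} ⊆ {x | ∀ i, i ∉ L → x i = a i} :=
    fun x hx j hj => hx j fun h => hj (hKL h)
  obtain ⟨c', hc', hc'D⟩ := hccc K _ ⟨a, rfl⟩ (hle.trans hsub) fun hm => by
    have heq := hm.2.2 _ ⟨L, a, rfl⟩ hsub hle
    have hmem : flipOn {i} a ∈ {x : Fin n → Bool | ∀ i, i ∉ L → x i = a i} :=
      flipOn_mem_of_isCubeOn ⟨a, rfl⟩ (fun _ _ => rfl) (Finset.singleton_subset_iff.2 hiL)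
    rw [heq] at hmem
    simpa [flipOn] using hmem i hiK
  exact hK (shatters_of_isCubeOn hc' hc'D)

/-- If `I` is a maximal shattered set of an extremal class, then there is only one cube of
colour set `I` in the class. -/
lemma Extremal.isCubeOn_unique {C c c' : Set (Fin n → Bool)} (hC : Extremal C)
    {I : Finset (Fin n)} (hI : ∀ L, Shatters C L → I ⊆ L → L = I)
    (hc : IsCubeOn I c) (hc' : IsCubeOn I c') (hcC : c ⊆ C) (hcC' : c' ⊆ C) : c = c' := by
  obtain ⟨v, hv, -⟩ := exists_mem_of_isCubeOn hc fun _ => false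
  obtain ⟨v', hv', hvv'⟩ := exists_mem_of_isCubeOn hc' v
  obtain ⟨a, ha⟩ := hC.exists_coeff (fun _ => v) (agreeInd v Finset.univ)
  have hIC : I ∈ shatteredSets C := mem_shatteredSets.2 (shatters_of_isCubeOn hc hcC)
  have hmax : ∀ L ∈ shatteredSets C, I ⊆ L → L ≠ I → a L = 0 := fun L hL hIL hne =>
    absurd (hI L (mem_shatteredSets.1 hL) hIL) hne
  have h1 := altSum_eq_coeff ha hIC hmax (u := v) (fun _ _ => rfl)
    fun A hA => hcC (flipOn_mem_of_isCubeOn hc hv hA)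
  have h2 := altSum_eq_coeff ha hIC hmax (u := v') hvv'
    fun A hA => hcC' (flipOn_mem_of_isCubeOn hc' hv' hA)
  rw [altSum_eq_apply fun A _ hA =>
    agreeInd_flipOn_eq_zero (fun _ _ => rfl) (Finset.subset_univ A) hA] at h1
  rw [altSum_eq_apply fun A hAI hA =>
    agreeInd_flipOn_eq_zero (fun i hi => hvv' i (hAI hi)) (Finset.subset_univ A) hA, ← h1] at h2
  have heq : v' = v := by
    by_contra hne
    have : ¬ ∀ i, v' i = v i := fun h => hne (funext h)
    simp [agreeInd, this] at h2
  subst heq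
  obtain ⟨b, rfl⟩ := hc
  obtain ⟨b', rfl⟩ := hc'
  ext x
  exact forall₂_congr fun i hi => by rw [← hv i hi, ← hv' i hi]

/-- For a proper pair `(C, D)` of extremal classes satisfying the
cubical colour condition, the special vertices `v, v'` of two distinct maximal cubes
`c, c'` of `C` not contained in `D`, with colour sets `I, I'`, differ on at least one
coordinate in `I ∪ I'`. -/
theorem special_vertices_differ (C D : Set (Fin n → Bool))
    (hC : Extremal C) (hD : Extremal D) (hsub : D ⊂ C) (hccc : CCC C D)
    (c c' : Set (Fin n → Bool)) (I I' : Finset (Fin n)) (hne : c ≠ c')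
    (hcI : IsCubeOn I c) (hcI' : IsCubeOn I' c')
    (hmax : MaximalCubeIn C c) (hmax' : MaximalCubeIn C c')
    (hnotD : ¬ c ⊆ D) (hnotD' : ¬ c' ⊆ D)
    (v v' : Fin n → Bool)
    (hv : v ∈ c ∧ proj I v ∉ proj I '' D)
    (hv' : v' ∈ c' ∧ proj I' v' ∉ proj I' '' D) :
    ∃ i ∈ I ∪ I', v i ≠ v' i := by
  have hID : ¬ Shatters D I := fun h => hv.2 (by rw [h]; trivial)
  have hID' : ¬ Shatters D I' := fun h => hv'.2 (by rw [h]; trivial)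
  have hIC := shatters_of_isCubeOn hcI hmax.2.1
  have hIC' := shatters_of_isCubeOn hcI' hmax'.2.1
  have hII' : I ≠ I' := by
    rintro rfl
    exact hne (hC.isCubeOn_unique (fun L hL => hccc.eq_of_subset hC hID hL) hcI hcI'
      hmax.2.1 hmax'.2.1)
  by_contra! hagree
  have hs : ∀ K, ∃ s : Fin n → Bool, (¬ Shatters D K → proj K s ∉ proj K '' D) ∧
      (K = I → s = v) ∧ (K = I' → s = v') := by
    intro K
    by_cases h : K = I
    · subst h
      exact ⟨v, fun _ => hv.2, fun _ => rfl, fun h => absurd h hII'⟩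
    by_cases h' : K = I'
    · subst h'
      exact ⟨v', fun _ => hv'.2, fun e => absurd e h, fun _ => rfl⟩
    by_cases hK : Shatters D K
    · exact ⟨v, fun e => absurd hK e, fun e => absurd e h, fun e => absurd e h'⟩
    · rw [shatters_iff] at hK
      push Not at hK
      obtain ⟨s, hs⟩ := hK
      refine ⟨s, fun _ ⟨x, hx, hxs⟩ => ?_, fun e => absurd e h, fun e => absurd e h'⟩
      obtain ⟨i, hi, hne⟩ := hs x hx
      exact hne (proj_eq_proj_iff.1 hxs i hi)
  choose s hsD hsI hsI' using hs
  have hDsC : shatteredSets D ⊆ shatteredSets C := fun K hK => by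
    rw [mem_shatteredSets, shatters_iff] at *
    exact fun t => let ⟨x, hx, hxt⟩ := hK t; ⟨x, hsub.1 hx, hxt⟩
  obtain ⟨a, ha⟩ := hC.exists_coeff s (agreeInd v (I ∪ I'))
  have hD0 : ∀ K ∈ shatteredSets D, a K = 0 := by
    refine coeff_eq_zero_of_sum_eq_zero (fun K hK => hD K (mem_shatteredSets.1 hK)) s
      fun x hx => ?_
    have h0 : agreeInd v (I ∪ I') x = 0 := if_neg fun h => hv.2
      ⟨x, hx, proj_eq_proj_iff.2 fun i hi => h i (Finset.mem_union_left _ hi)⟩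
    rw [← h0, ha x (hsub.1 hx)]
    refine Finset.sum_subset hDsC fun L _ hL => ?_
    rw [mem_shatteredSets] at hL
    have : agreeInd (s L) L x = 0 := if_neg fun h => hsD L hL ⟨x, hx, proj_eq_proj_iff.2 h⟩
    rw [this, mul_zero]
  have hcoeff : ∀ K, Shatters C K → ¬ Shatters D K → ∀ c, IsCubeOn K c → c ⊆ C → ∀ u ∈ c,
      (∀ i ∈ K, u i = s K i) → altSum K u (agreeInd v (I ∪ I')) = a K := by
    intro K hKC hKD c hc hcC u hu hus
    refine altSum_eq_coeff ha (mem_shatteredSets.2 hKC) (fun L hL hKL hne => ?_) hus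
      fun A hA => hcC (flipOn_mem_of_isCubeOn hc hu hA)
    exact absurd (hccc.eq_of_subset hC hKD (mem_shatteredSets.1 hL) hKL) hne
  have haI : a I = 1 := by
    rw [← hcoeff I hIC hID c hcI hmax.2.1 v hv.1 (fun i _ => by rw [hsI I rfl]),
      altSum_eq_apply fun A hA hne => agreeInd_flipOn_eq_zero (fun _ _ => rfl)
        (hA.trans Finset.subset_union_left) hne]
    exact if_pos fun _ _ => rfl
  have haI' : a I' = 1 := by
    rw [← hcoeff I' hIC' hID' c' hcI' hmax'.2.1 v' hv'.1 (fun i _ => by rw [hsI' I' rfl]),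
      altSum_eq_apply fun A hA hne => agreeInd_flipOn_eq_zero
        (fun i hi => (hagree i (Finset.mem_union_right _ (hA hi))).symm)
        (hA.trans Finset.subset_union_right) hne]
    exact if_pos fun i hi => (hagree i hi).symm
  have hnonneg : ∀ K ∈ shatteredSets C, 0 ≤ a K * agreeInd (s K) K v := by
    intro K hK
    by_cases hKD : Shatters D K
    · rw [hD0 K (mem_shatteredSets.2 hKD), zero_mul]
    by_cases hvK : ∀ i ∈ K, v i = s K i
    · rw [agreeInd, if_pos hvK, mul_one]
      rw [mem_shatteredSets] at hK
      obtain ⟨d, hd, hdC⟩ := hC K hK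
      obtain ⟨u, hu, hus⟩ := exists_mem_of_isCubeOn hd (s K)
      rw [← hcoeff K hK hKD d hd hdC u hu hus]
      by_cases hKJ : K ⊆ I ∪ I'
      · rw [altSum_eq_apply fun A hA hne => agreeInd_flipOn_eq_zero
          (fun i hi => (hus i (hA hi)).trans (hvK i (hA hi)).symm) (hA.trans hKJ) hne, agreeInd]
        split_ifs <;> norm_num
      · rw [altSum_agreeInd_eq_zero hKJ]
    · rw [agreeInd, if_neg hvK, mul_zero]
  have hvsum := ha v (hmax.2.1 hv.1)
  have hpair : ({I, I'} : Finset (Finset (Fin n))) ⊆ shatteredSets C := by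
    intro K hK
    rw [Finset.mem_insert, Finset.mem_singleton] at hK
    rcases hK with rfl | rfl
    exacts [mem_shatteredSets.2 hIC, mem_shatteredSets.2 hIC']
  have hle := Finset.sum_le_sum_of_subset_of_nonneg hpair fun K hK _ => hnonneg K hK
  have h1 : agreeInd (s I) I v = 1 := if_pos fun i _ => by rw [hsI I rfl]
  have h2 : agreeInd (s I') I' v = 1 := if_pos fun i hi => by
    rw [hsI' I' rfl, hagree i (Finset.mem_union_right _ hi)]
  have h3 : agreeInd v (I ∪ I') v = 1 := if_pos fun _ _ => rfl
  rw [Finset.sum_pair hII', haI, haI', h1, h2, ← hvsum, h3] at hle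
  norm_num at hle
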